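/- (Signal term, ReLU vs. affine tasks.) For every w ≥ 0 and every L > 0, the signal term for the ReLU task distribution is at least half the signal term for the affine task distribution: L_b(w; D(F^+_L)) ≥ L_b(w; D(F^aff_L)) / 2. -/

import Mathlib

open MeasureTheory Real

noncomputable section

/-- Uniform probability measure on the unit sphere `S^{d-1} ⊆ ℝ^d`, defined as the
normalized `(d-1)`-dimensional Hausdorff measure restricted to the sphere. -/
def sphereUniform (d : ℕ) : Measure (EuclideanSpace ℝ (Fin d)) :=
  ((μH[(d : ℝ) - 1]) (Metric.sphere (0 : EuclideanSpace ℝ (Fin d)) 1))⁻¹ •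
    (μH[(d : ℝ) - 1]).restrict (Metric.sphere (0 : EuclideanSpace ℝ (Fin d)) 1)

/-- Uniform probability measure on the interval `[-L, L]`. -/
def unifIcc (L : ℝ) : Measure ℝ :=
  (ENNReal.ofReal (2 * L))⁻¹ • (volume.restrict (Set.Icc (-L) L))

/-- The softmax attention weight
`γ_i(w) = exp(-w ‖x_i - x_{n+1}‖²) / Σ_j exp(-w ‖x_j - x_{n+1}‖²)`. -/
def attnW {d n : ℕ} (w : ℝ) (x : Fin (n + 1) → EuclideanSpace ℝ (Fin d)) (i : Fin n) : ℝ :=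
  Real.exp (-w * ‖x i.castSucc - x (Fin.last n)‖ ^ 2) /
    ∑ j : Fin n, Real.exp (-w * ‖x j.castSucc - x (Fin.last n)‖ ^ 2)

/-- The signal (bias) term `L_b(w; D)`: the task parameter `θ` is drawn from `τ`
(with task function `F θ`) and the covariates `x_1, …, x_{n+1}` are i.i.d. uniform
on the sphere. -/
def signalTerm (d n : ℕ) {Θ : Type*} [MeasurableSpace Θ] (τ : Measure Θ)
    (F : Θ → EuclideanSpace ℝ (Fin d) → ℝ) (w : ℝ) : ℝ :=
  ∫ θ, ∫ x : Fin (n + 1) → EuclideanSpace ℝ (Fin d),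
      (∑ i : Fin n, attnW w x i * (F θ (x (Fin.last n)) - F θ (x i.castSucc))) ^ 2
    ∂(Measure.pi fun _ : Fin (n + 1) => sphereUniform d) ∂τ

/-- The parameter distribution of the affine task class `D(F^aff_L)`:
`v` uniform on the sphere, `l, b` i.i.d. uniform on `[-L, L]`. -/
def affineTask (d : ℕ) (L : ℝ) : Measure (EuclideanSpace ℝ (Fin d) × ℝ × ℝ) :=
  (sphereUniform d).prod ((unifIcc L).prod (unifIcc L))

/-- The affine task function `f(x) = l ⬝ vᵀx + b` with parameter `θ = (v, l, b)`. -/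
def affineF {d : ℕ} (θ : EuclideanSpace ℝ (Fin d) × ℝ × ℝ)
    (x : EuclideanSpace ℝ (Fin d)) : ℝ :=
  θ.2.1 * (∑ a, θ.1 a * x a) + θ.2.2

/-- The parameter distribution of the ReLU task class `D(F^+_L)`. -/
def reluTask (d : ℕ) (L : ℝ) : Measure (EuclideanSpace ℝ (Fin d) × ℝ × ℝ × ℝ) :=
  (sphereUniform d).prod ((unifIcc L).prod ((unifIcc L).prod (unifIcc L)))

/-- The ReLU task function `f(x) = l₁ max(vᵀx, 0) + l₂ max(-vᵀx, 0) + b`. -/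
def reluF {d : ℕ} (θ : EuclideanSpace ℝ (Fin d) × ℝ × ℝ × ℝ)
    (x : EuclideanSpace ℝ (Fin d)) : ℝ :=
  θ.2.1 * max (∑ a, θ.1 a * x a) 0 + θ.2.2.1 * max (-(∑ a, θ.1 a * x a)) 0 + θ.2.2.2

lemma sphereUniform_eq_zero_or_isProbabilityMeasure (d : ℕ) :
    sphereUniform d = 0 ∨ IsProbabilityMeasure (sphereUniform d) := by
  set c := (μH[(d : ℝ) - 1]) (Metric.sphere (0 : EuclideanSpace ℝ (Fin d)) 1) with hc
  by_cases h0 : c = 0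
  · left
    rw [sphereUniform, Measure.restrict_eq_zero.2 (hc ▸ h0), smul_zero]
  by_cases ht : c = ⊤
  · left
    rw [sphereUniform, ← hc, ht, ENNReal.inv_top, zero_smul]
  · right
    constructor
    simp [sphereUniform, ← hc, ENNReal.inv_mul_cancel h0 ht]

lemma ae_norm_eq_one_sphereUniform (d : ℕ) : ∀ᵐ v ∂(sphereUniform d), ‖v‖ = 1 := by
  refine Measure.ae_smul_measure ?_ _
  filter_upwards [ae_restrict_mem (Metric.isClosed_sphere.measurableSet)] with v hv
  simpa using hv

lemma isProbabilityMeasure_unifIcc {L : ℝ} (hL : 0 < L) : IsProbabilityMeasure (unifIcc L) := by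
  constructor
  have h : (L - -L) = 2 * L := by ring
  simp only [unifIcc, Measure.smul_apply, Measure.restrict_apply_univ, Real.volume_Icc, h,
    smul_eq_mul]
  exact ENNReal.inv_mul_cancel (by simpa using hL) ENNReal.ofReal_ne_top

lemma integrable_unifIcc_of_continuous {L : ℝ} (hL : 0 < L) {f : ℝ → ℝ} (hf : Continuous f) :
    Integrable f (unifIcc L) := by
  refine Integrable.smul_measure (hf.continuousOn.integrableOn_compact isCompact_Icc) ?_
  simpa using hL

lemma integral_id_unifIcc {L : ℝ} (hL : 0 < L) : ∫ l, l ∂(unifIcc L) = 0 := by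
  rw [unifIcc, integral_smul_measure, integral_Icc_eq_integral_Ioc,
    ← intervalIntegral.integral_of_le (by linarith), integral_id]
  simp

lemma measurable_posRamp : Measurable fun s : ℝ => max s 0 := by fun_prop

lemma measurable_negRamp : Measurable fun s : ℝ => max (-s) 0 := by fun_prop

lemma abs_posRamp_le (s : ℝ) : |max s 0| ≤ |s| := by
  rw [abs_of_nonneg (le_max_right s 0)]
  exact max_le (le_abs_self s) (abs_nonneg s)

lemma abs_negRamp_le (s : ℝ) : |max (-s) 0| ≤ |s| := by
  simpa using abs_posRamp_le (-s)

/-- The deviation of the attention average of the ridge function `φ (vᵀx)` from its value at the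
last covariate. -/
def ridgeBias {d n : ℕ} (w : ℝ) (φ : ℝ → ℝ) (v : EuclideanSpace ℝ (Fin d))
    (x : Fin (n + 1) → EuclideanSpace ℝ (Fin d)) : ℝ :=
  ∑ i : Fin n, attnW w x i *
    (φ (∑ a, v a * x (Fin.last n) a) - φ (∑ a, v a * x i.castSucc a))

lemma attnW_nonneg {d n : ℕ} (w : ℝ) (x : Fin (n + 1) → EuclideanSpace ℝ (Fin d)) (i : Fin n) :
    0 ≤ attnW w x i := by
  unfold attnW; positivity

lemma attnW_le_one {d n : ℕ} (w : ℝ) (x : Fin (n + 1) → EuclideanSpace ℝ (Fin d)) (i : Fin n) :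
    attnW w x i ≤ 1 := by
  unfold attnW
  refine div_le_one_of_le₀ ?_ (by positivity)
  exact Finset.single_le_sum
    (f := fun j : Fin n => Real.exp (-w * ‖x j.castSucc - x (Fin.last n)‖ ^ 2))
    (fun j _ => (Real.exp_pos _).le) (Finset.mem_univ i)

lemma measurable_attnW {d n : ℕ} (w : ℝ) (i : Fin n) :
    Measurable fun x : Fin (n + 1) → EuclideanSpace ℝ (Fin d) => attnW w x i := by
  unfold attnW
  fun_prop

lemma measurable_ridgeBias {d n : ℕ} (w : ℝ) {φ : ℝ → ℝ} (hφ : Measurable φ) :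
    Measurable fun z : EuclideanSpace ℝ (Fin d) × (Fin (n + 1) → EuclideanSpace ℝ (Fin d)) =>
      ridgeBias w φ z.1 z.2 := by
  unfold ridgeBias
  refine Finset.measurable_sum _ fun i _ => ?_
  refine ((measurable_attnW w i).comp measurable_snd).mul ((hφ.comp ?_).sub (hφ.comp ?_)) <;>
    fun_prop

lemma abs_sum_mul_le_norm_mul_norm {d : ℕ} (v x : EuclideanSpace ℝ (Fin d)) :
    |∑ a, v a * x a| ≤ ‖v‖ * ‖x‖ := by
  have h := abs_real_inner_le_norm v x
  simpa [PiLp.inner_apply, mul_comm] using h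

lemma abs_ridgeBias_le {d n : ℕ} (w : ℝ) {φ : ℝ → ℝ} (hφ : ∀ s, |φ s| ≤ |s|)
    {v : EuclideanSpace ℝ (Fin d)} {x : Fin (n + 1) → EuclideanSpace ℝ (Fin d)}
    (hv : ‖v‖ = 1) (hx : ∀ i, ‖x i‖ = 1) : |ridgeBias w φ v x| ≤ n * 2 := by
  have hb : ∀ i, |φ (∑ a, v a * x i a)| ≤ 1 := fun i =>
    (hφ _).trans ((abs_sum_mul_le_norm_mul_norm v (x i)).trans (by simp [hv, hx i]))
  calc |ridgeBias w φ v x| ≤ ∑ i : Fin n, |attnW w x i *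
        (φ (∑ a, v a * x (Fin.last n) a) - φ (∑ a, v a * x i.castSucc a))| :=
        Finset.abs_sum_le_sum_abs _ _
    _ ≤ ∑ _i : Fin n, (2 : ℝ) := by
        refine Finset.sum_le_sum fun i _ => ?_
        rw [abs_mul, abs_of_nonneg (attnW_nonneg w x i)]
        have h1 := (abs_sub _ _).trans (add_le_add (hb (Fin.last n)) (hb i.castSucc))
        calc _ ≤ 1 * (1 + 1 : ℝ) :=
              mul_le_mul (attnW_le_one w x i) h1 (abs_nonneg _) zero_le_one
          _ = 2 := by norm_num
    _ = n * 2 := by simp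

lemma integrable_ridgeBias_mul {d n : ℕ} [IsProbabilityMeasure (sphereUniform d)] (w : ℝ)
    {φ ψ : ℝ → ℝ} (hφ : Measurable φ) (hψ : Measurable ψ) (hφ' : ∀ s, |φ s| ≤ |s|)
    (hψ' : ∀ s, |ψ s| ≤ |s|) :
    Integrable (fun z : EuclideanSpace ℝ (Fin d) × (Fin (n + 1) → EuclideanSpace ℝ (Fin d)) =>
      ridgeBias w φ z.1 z.2 * ridgeBias w ψ z.1 z.2)
      ((sphereUniform d).prod (Measure.pi fun _ : Fin (n + 1) => sphereUniform d)) := by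
  refine Integrable.of_bound
    ((measurable_ridgeBias w hφ).mul (measurable_ridgeBias w hψ)).aestronglyMeasurable
    ((n * 2) * (n * 2)) ?_
  have hv := (Measure.quasiMeasurePreserving_fst (μ := sphereUniform d)
    (ν := Measure.pi fun _ : Fin (n + 1) => sphereUniform d)).ae (ae_norm_eq_one_sphereUniform d)
  have hx := (Measure.quasiMeasurePreserving_snd (μ := sphereUniform d)
    (ν := Measure.pi fun _ : Fin (n + 1) => sphereUniform d)).ae
    (ae_all_iff.2 fun i => (Measure.quasiMeasurePreserving_eval
      (fun _ : Fin (n + 1) => sphereUniform d) i).ae (ae_norm_eq_one_sphereUniform d))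
  filter_upwards [hv, hx] with z hz1 hz2
  rw [Real.norm_eq_abs, abs_mul]
  exact mul_le_mul (abs_ridgeBias_le w hφ' hz1 hz2) (abs_ridgeBias_le w hψ' hz1 hz2)
    (abs_nonneg _) (by positivity)

/-- The covariate-and-direction average of the product of two ridge biases. -/
def ridgeCov (d n : ℕ) (w : ℝ) (φ ψ : ℝ → ℝ) : ℝ :=
  ∫ v, ∫ x : Fin (n + 1) → EuclideanSpace ℝ (Fin d), ridgeBias w φ v x * ridgeBias w ψ v x
    ∂(Measure.pi fun _ : Fin (n + 1) => sphereUniform d) ∂(sphereUniform d)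

lemma signalTerm_affine {d n : ℕ} [IsProbabilityMeasure (sphereUniform d)] (w : ℝ) {L : ℝ}
    (hL : 0 < L) :
    signalTerm d n (affineTask d L) affineF w =
      (∫ l, l ^ 2 ∂(unifIcc L)) * ridgeCov d n w id id := by
  have := isProbabilityMeasure_unifIcc hL
  have hpt : ∀ (θ : EuclideanSpace ℝ (Fin d) × ℝ × ℝ)
      (x : Fin (n + 1) → EuclideanSpace ℝ (Fin d)),
      (∑ i : Fin n, attnW w x i * (affineF θ (x (Fin.last n)) - affineF θ (x i.castSucc))) ^ 2
        = θ.2.1 ^ 2 * (ridgeBias w id θ.1 x * ridgeBias w id θ.1 x) := by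
    intro θ x
    have : ∑ i : Fin n, attnW w x i * (affineF θ (x (Fin.last n)) - affineF θ (x i.castSucc))
        = θ.2.1 * ridgeBias w id θ.1 x := by
      simp only [ridgeBias, affineF, id, Finset.mul_sum (s := (Finset.univ : Finset (Fin n)))]
      exact Finset.sum_congr rfl fun i _ => by ring
    rw [this]; ring
  simp only [signalTerm, hpt, integral_const_mul, affineTask]
  simp_rw [mul_comm (_ ^ 2)]
  rw [integral_prod_mul (μ := sphereUniform d) (ν := (unifIcc L).prod (unifIcc L))
    (fun v => ∫ x : Fin (n + 1) → EuclideanSpace ℝ (Fin d), ridgeBias w id v x * ridgeBias w id v x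
    ∂(Measure.pi fun _ : Fin (n + 1) => sphereUniform d)) (fun l : ℝ × ℝ => l.1 ^ 2)]
  rw [integral_fun_fst (fun l : ℝ => l ^ 2)]
  simp [ridgeCov, mul_comm]

lemma signalTerm_relu {d n : ℕ} [IsProbabilityMeasure (sphereUniform d)] (w : ℝ) {L : ℝ}
    (hL : 0 < L) :
    signalTerm d n (reluTask d L) reluF w =
      (∫ l, l ^ 2 ∂(unifIcc L)) *
        (ridgeCov d n w (max · 0) (max · 0) +
          ridgeCov d n w (fun s => max (-s) 0) (fun s => max (-s) 0)) := by
  have := isProbabilityMeasure_unifIcc hL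
  set p : ℝ → ℝ := (max · 0) with hp
  set q : ℝ → ℝ := fun s => max (-s) 0 with hq
  set M := Measure.pi fun _ : Fin (n + 1) => sphereUniform d with hM
  have hpq : ∀ (θ : EuclideanSpace ℝ (Fin d) × ℝ × ℝ × ℝ)
      (x : Fin (n + 1) → EuclideanSpace ℝ (Fin d)),
      (∑ i : Fin n, attnW w x i * (reluF θ (x (Fin.last n)) - reluF θ (x i.castSucc))) ^ 2
        = θ.2.1 ^ 2 * (ridgeBias w p θ.1 x * ridgeBias w p θ.1 x)
          + 2 * (θ.2.1 * θ.2.2.1) * (ridgeBias w p θ.1 x * ridgeBias w q θ.1 x)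
          + θ.2.2.1 ^ 2 * (ridgeBias w q θ.1 x * ridgeBias w q θ.1 x) := by
    intro θ x
    have : ∑ i : Fin n, attnW w x i * (reluF θ (x (Fin.last n)) - reluF θ (x i.castSucc))
        = θ.2.1 * ridgeBias w p θ.1 x + θ.2.2.1 * ridgeBias w q θ.1 x := by
      simp only [ridgeBias, reluF, hp, hq, Finset.mul_sum (s := (Finset.univ : Finset (Fin n))),
        ← Finset.sum_add_distrib]
      exact Finset.sum_congr rfl fun i _ => by ring
    rw [this]; ring
  have ipp := integrable_ridgeBias_mul (d := d) (n := n) w measurable_posRamp measurable_posRamp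
    abs_posRamp_le abs_posRamp_le
  have ipq := integrable_ridgeBias_mul (d := d) (n := n) w measurable_posRamp measurable_negRamp
    abs_posRamp_le abs_negRamp_le
  have iqq := integrable_ridgeBias_mul (d := d) (n := n) w measurable_negRamp measurable_negRamp
    abs_negRamp_le abs_negRamp_le
  have hinner : ∀ᵐ θ ∂(reluTask d L),
      ∫ x, (∑ i : Fin n, attnW w x i * (reluF θ (x (Fin.last n)) - reluF θ (x i.castSucc))) ^ 2 ∂M
        = (∫ x, ridgeBias w p θ.1 x * ridgeBias w p θ.1 x ∂M) * θ.2.1 ^ 2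
          + (∫ x, ridgeBias w p θ.1 x * ridgeBias w q θ.1 x ∂M) * (2 * (θ.2.1 * θ.2.2.1))
          + (∫ x, ridgeBias w q θ.1 x * ridgeBias w q θ.1 x ∂M) * θ.2.2.1 ^ 2 := by
    have h : ∀ᵐ v ∂(sphereUniform d), _ :=
      (ipp.prod_right_ae.and (ipq.prod_right_ae.and iqq.prod_right_ae))
    filter_upwards [(Measure.quasiMeasurePreserving_fst (μ := sphereUniform d)
      (ν := (unifIcc L).prod ((unifIcc L).prod (unifIcc L)))).ae h] with θ hθ
    obtain ⟨h1, h2, h3⟩ := hθ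
    simp_rw [hpq]
    rw [integral_add, integral_add, integral_const_mul, integral_const_mul, integral_const_mul]
    · ring
    · exact h1.const_mul _
    · exact h2.const_mul _
    · exact (h1.const_mul _).add (h2.const_mul _)
    · exact h3.const_mul _
  have hsq := integrable_unifIcc_of_continuous hL (continuous_pow 2)
  have hid := integrable_unifIcc_of_continuous hL continuous_id
  have j1 : Integrable (fun l : ℝ × ℝ × ℝ => l.1 ^ 2)
      ((unifIcc L).prod ((unifIcc L).prod (unifIcc L))) := hsq.comp_fst _
  have j2 : Integrable (fun l : ℝ × ℝ × ℝ => 2 * (l.1 * l.2.1))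
      ((unifIcc L).prod ((unifIcc L).prod (unifIcc L))) :=
    (hid.mul_prod (hid.comp_fst (unifIcc L))).const_mul 2
  have j3 : Integrable (fun l : ℝ × ℝ × ℝ => l.2.1 ^ 2)
      ((unifIcc L).prod ((unifIcc L).prod (unifIcc L))) := (hsq.comp_fst _).comp_snd _
  have e1 : ∫ l : ℝ × ℝ × ℝ, l.1 ^ 2 ∂((unifIcc L).prod ((unifIcc L).prod (unifIcc L)))
      = ∫ l, l ^ 2 ∂(unifIcc L) := by
    rw [integral_fun_fst (fun l : ℝ => l ^ 2)]; simp
  have e2 : ∫ l : ℝ × ℝ × ℝ, 2 * (l.1 * l.2.1) ∂((unifIcc L).prod ((unifIcc L).prod (unifIcc L)))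
      = 0 := by
    rw [integral_const_mul, integral_prod_mul (fun l : ℝ => l) (fun l : ℝ × ℝ => l.1),
      integral_id_unifIcc hL]
    simp
  have e3 : ∫ l : ℝ × ℝ × ℝ, l.2.1 ^ 2 ∂((unifIcc L).prod ((unifIcc L).prod (unifIcc L)))
      = ∫ l, l ^ 2 ∂(unifIcc L) := by
    rw [integral_fun_snd (fun l : ℝ × ℝ => l.1 ^ 2), integral_fun_fst (fun l : ℝ => l ^ 2)]; simp
  rw [signalTerm, integral_congr_ae hinner, reluTask, integral_add, integral_add,
    integral_prod_mul (fun v => ∫ x, ridgeBias w p v x * ridgeBias w p v x ∂M)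
      (fun l : ℝ × ℝ × ℝ => l.1 ^ 2),
    integral_prod_mul (fun v => ∫ x, ridgeBias w p v x * ridgeBias w q v x ∂M)
      (fun l : ℝ × ℝ × ℝ => 2 * (l.1 * l.2.1)),
    integral_prod_mul (fun v => ∫ x, ridgeBias w q v x * ridgeBias w q v x ∂M)
      (fun l : ℝ × ℝ × ℝ => l.2.1 ^ 2), e1, e2, e3]
  · simp only [ridgeCov]
    ring
  · exact ipp.integral_prod_left.mul_prod j1
  · exact ipq.integral_prod_left.mul_prod j2
  · exact (ipp.integral_prod_left.mul_prod j1).add (ipq.integral_prod_left.mul_prod j2)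
  · exact iqq.integral_prod_left.mul_prod j3

lemma ridgeBias_id {d n : ℕ} (w : ℝ) (v : EuclideanSpace ℝ (Fin d))
    (x : Fin (n + 1) → EuclideanSpace ℝ (Fin d)) :
    ridgeBias w id v x = ridgeBias w (max · 0) v x - ridgeBias w (fun s => max (-s) 0) v x := by
  have h : ∀ s : ℝ, s = max s 0 - max (-s) 0 := fun s => by
    rcases le_total s 0 with hs | hs <;> simp [hs]
  simp only [ridgeBias, id]
  rw [← Finset.sum_sub_distrib]
  refine Finset.sum_congr rfl fun i _ => ?_
  linear_combination attnW w x i * (h (∑ a, v a * x (Fin.last n) a))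
    - attnW w x i * (h (∑ a, v a * x i.castSucc a))

lemma ridgeCov_id_le (d n : ℕ) [IsProbabilityMeasure (sphereUniform d)] (w : ℝ) :
    ridgeCov d n w id id ≤ 2 * (ridgeCov d n w (max · 0) (max · 0) +
      ridgeCov d n w (fun s => max (-s) 0) (fun s => max (-s) 0)) := by
  have iid := integrable_ridgeBias_mul (d := d) (n := n) w measurable_id measurable_id
    (fun _ => le_rfl) (fun _ => le_rfl)
  have ipp := integrable_ridgeBias_mul (d := d) (n := n) w measurable_posRamp measurable_posRamp
    abs_posRamp_le abs_posRamp_le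
  have iqq := integrable_ridgeBias_mul (d := d) (n := n) w measurable_negRamp measurable_negRamp
    abs_negRamp_le abs_negRamp_le
  unfold ridgeCov
  rw [← integral_prod _ iid, ← integral_prod _ ipp, ← integral_prod _ iqq, ← integral_add ipp iqq,
    ← integral_const_mul]
  refine integral_mono iid ((ipp.add iqq).const_mul 2) fun z => ?_
  simp only [ridgeBias_id w z.1 z.2]
  nlinarith [sq_nonneg (ridgeBias w (max · 0) z.1 z.2 + ridgeBias w (fun s => max (-s) 0) z.1 z.2)]

/-- Lemma 14 (signal term, ReLU vs. affine tasks): the ReLU signal term is at least half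
the affine signal term. -/
theorem relu_signal_ge_half_affine (d n : ℕ) (hd : 2 ≤ d) (hn : 2 ≤ n)
    (w L : ℝ) (hw : 0 ≤ w) (hL : 0 < L) :
    signalTerm d n (affineTask d L) affineF w / 2 ≤
      signalTerm d n (reluTask d L) reluF w := by
  rcases sphereUniform_eq_zero_or_isProbabilityMeasure d with h | h
  · simp [signalTerm, affineTask, reluTask, h]
  · rw [signalTerm_affine w hL, signalTerm_relu w hL]
    have hc : 0 ≤ ∫ l, l ^ 2 ∂(unifIcc L) := integral_nonneg fun l => sq_nonneg l
    linarith [mul_le_mul_of_nonneg_left (ridgeCov_id_le d n w) hc]
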